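/- arXiv:1811.05420 — 3 statements merged into one kernel-verified Lean document; each statement's English description precedes it below -/
import Mathlib

section
/- Let O be a theory, V a finite set of sentences with enumeration β_1, …, β_m, and V* the result of single-pass redundancy elimination applied to V. Then for every β ∈ V*, O ∪ (V* ∖ {β}) ⊭ β; in particular, O ⊭ β for every β ∈ V*. -/
open FirstOrder Language

namespace Abduction

variable {L' L : FirstOrder.Language}

/-- An `L`-sentence is an `S_A`-sentence (w.r.t. the language homomorphism `ι`)
if it is the image under `ι` of some `L'`-sentence. -/
def IsSA (ι : L' →ᴸ L) (φ : L.Sentence) : Prop :=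
  ∃ β : L'.Sentence, ι.onSentence β = φ

/-- `V` is a uniform interpolant of `O` for the abducible signature given by `ι`:
`V` is an `S_A`-theory and for every `S_A`-sentence `β`, `O ⊨ β` iff `V ⊨ β`. -/
def IsUniformInterpolant (ι : L' →ᴸ L) (O V : L.Theory) : Prop :=
  (∀ β ∈ V, IsSA ι β) ∧ ∀ φ : L.Sentence, IsSA ι φ → ((O ⊨ᵇ φ) ↔ (V ⊨ᵇ φ))

/-- Finite disjunction `b 0 ∨ ... ∨ b (n-1)`; the empty disjunction is `⊥`. -/
def disj {L : FirstOrder.Language} : {n : ℕ} → (Fin n → L.Sentence) → L.Sentence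
  | 0, _ => ⊥
  | _ + 1, b => b 0 ⊔ disj fun i => b i.succ

/-- Disjunction of a list of sentences; the empty disjunction is `⊥`. -/
def ldisj {L : FirstOrder.Language} : List L.Sentence → L.Sentence
  | [] => ⊥
  | φ :: rest => φ ⊔ ldisj rest

open Classical in
/-- Single-pass redundancy elimination: go through the enumeration, removing an axiom
if it is entailed by `O` together with the remaining axioms. -/
noncomputable def spre (O : L.Theory) : List L.Sentence → L.Theory → L.Theory
  | [], R => R
  | β :: rest, R => spre O rest (if (O ∪ (R \ {β})) ⊨ᵇ β then R \ {β} else R)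


/-- Entailment is monotone in the theory. -/
theorem modelsBoundedFormula_mono {T T' : L.Theory} (h : T ⊆ T') {φ : L.Sentence}
    (hφ : T ⊨ᵇ φ) : T' ⊨ᵇ φ :=
  Theory.models_of_models_theory (fun _ hψ => Theory.models_sentence_of_mem (h hψ)) hφ

/-- Redundancy elimination only removes axioms. -/
theorem spre_subset (O : L.Theory) (l : List L.Sentence) (R : L.Theory) : spre O l R ⊆ R := by
  induction l generalizing R with
  | nil => exact subset_rfl
  | cons γ l ih =>
    rw [spre]
    refine (ih _).trans ?_
    split_ifs
    · exact Set.sdiff_subset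
    · exact subset_rfl

/-- An axiom that is processed and survives is not entailed by `O` with the remaining result. -/
theorem not_models_of_mem_spre (O : L.Theory) {l : List L.Sentence} {R : L.Theory}
    {β : L.Sentence} (hl : β ∈ l) (hβ : β ∈ spre O l R) :
    ¬ ((O ∪ (spre O l R \ {β})) ⊨ᵇ β) := by
  induction l generalizing R with
  | nil => simp at hl
  | cons γ l ih =>
    rw [spre] at hβ ⊢
    rcases List.mem_cons.1 hl with rfl | hl
    · split_ifs at hβ ⊢ with h
      · exact absurd rfl (spre_subset O l _ hβ).2
      · exact fun hc => h (modelsBoundedFormula_mono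
          (Set.union_subset_union_right O (Set.sdiff_subset_sdiff_left (spre_subset O l R))) hc)
    · exact ih hl hβ

/-- The result of single-pass redundancy elimination contains no
axiom entailed by `O` together with the remaining axioms; in particular no axiom
entailed by `O` alone. -/
theorem spre_no_redundancy
    (O : L.Theory) (l : List L.Sentence) (V : L.Theory)
    (hnd : l.Nodup) (hV : V = {φ | φ ∈ l}) :
    (∀ β ∈ spre O l V, ¬ ((O ∪ (spre O l V \ {β})) ⊨ᵇ β)) ∧
      ∀ β ∈ spre O l V, ¬ (O ⊨ᵇ β) := by
  subst hV
  have key : ∀ β ∈ spre O l {φ | φ ∈ l}, ¬ ((O ∪ (spre O l {φ | φ ∈ l} \ {β})) ⊨ᵇ β) :=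
    fun β hβ => not_models_of_mem_spre O (spre_subset O l _ hβ) hβ
  exact ⟨key, fun β hβ h => key β hβ (modelsBoundedFormula_mono Set.subset_union_left h)⟩

end Abduction
end

section
/- Let O be an L-theory, ψ an L-sentence, V a uniform interpolant of O ∪ {¬ψ} for S_A, and V* ⊆ V a subset such that O ∪ V* ⊨ β for every β ∈ V ∖ V*. Let W be an S_A-theory with O ∪ {¬ψ} ⊨ W. If O ∪ W ⊨ β for every β ∈ O ∪ V*, then O ∪ V* ⊨ β for every β ∈ O ∪ W; hence the theories O ∪ V* and O ∪ W entail exactly the same sentences. -/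
open FirstOrder Language

namespace Abduction

variable {L' L : FirstOrder.Language}

/-- Transitivity of entailment between theories. -/
theorem models_trans {L : FirstOrder.Language} {S T : L.Theory} {φ : L.Sentence}
    (hST : ∀ β ∈ T, S ⊨ᵇ β) (hT : T ⊨ᵇ φ) : S ⊨ᵇ φ := by
  rw [Theory.models_sentence_iff]
  intro M
  have : M ⊨ T := ⟨fun β hβ => (hST β hβ).realize_sentence M⟩
  exact hT.realize_sentence M

/-- If `W` is an `S_A`-theory entailed by `O ∪ {¬ψ}` and `O ∪ W` entails
`O ∪ V*`, then `O ∪ V*` entails `O ∪ W`; hence the two theories entail the same sentences. -/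
theorem reducedUI_equiv_of_entails
    (ι : L' →ᴸ L) (O : L.Theory) (ψ : L.Sentence) (V Vstar : L.Theory)
    (hUI : IsUniformInterpolant ι (O ∪ {ψ.not}) V)
    (hsub : Vstar ⊆ V)
    (hred : ∀ β ∈ V \ Vstar, (O ∪ Vstar) ⊨ᵇ β)
    (W : L.Theory) (hW : ∀ β ∈ W, IsSA ι β)
    (hWent : ∀ β ∈ W, (O ∪ {ψ.not}) ⊨ᵇ β)
    (hWV : ∀ β ∈ O ∪ Vstar, (O ∪ W) ⊨ᵇ β) :
    (∀ β ∈ O ∪ W, (O ∪ Vstar) ⊨ᵇ β) ∧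
      ∀ φ : L.Sentence, ((O ∪ Vstar) ⊨ᵇ φ) ↔ ((O ∪ W) ⊨ᵇ φ) := by
  have hV : ∀ β ∈ V, (O ∪ Vstar) ⊨ᵇ β := by
    intro β hβ
    by_cases h : β ∈ Vstar
    · exact Theory.models_sentence_of_mem (Or.inr h)
    · exact hred β ⟨hβ, h⟩
  have hWV' : ∀ β ∈ O ∪ W, (O ∪ Vstar) ⊨ᵇ β := by
    rintro β (hβ | hβ)
    · exact Theory.models_sentence_of_mem (Or.inl hβ)
    · exact models_trans hV ((hUI.2 β (hW β hβ)).1 (hWent β hβ))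
  exact ⟨hWV', fun φ => ⟨models_trans hWV, models_trans hWV'⟩⟩

end Abduction
end

section
/- Let O be an L-theory, ψ an L-sentence, V a finite uniform interpolant of O ∪ {¬ψ} for S_A, and V* = {β_1, …, β_n} ⊆ V a subset such that O ∪ V* ⊨ β for every β ∈ V ∖ V*; let H = ¬β_1 ∨ … ∨ ¬β_n be the associated hypothesis. Then for every S_A-sentence H' with O ∪ {H'} ⊨ ψ, it holds that O ∪ {H'} ⊨ H. (The hypothesis obtained by negating the reduced uniform interpolant is semantically minimal: it is entailed, relative to O, by every hypothesis over the abducible signature.) -/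
open FirstOrder Language

namespace Abduction

variable {L' L : FirstOrder.Language}

theorem IsSA.not {ι : L' →ᴸ L} {φ : L.Sentence} (h : IsSA ι φ) : IsSA ι φ.not := by
  obtain ⟨β, rfl⟩ := h
  exact ⟨β.not, rfl⟩

theorem realize_disj {M : Type*} [L.Structure M] {n : ℕ} (b : Fin n → L.Sentence) :
    M ⊨ disj b ↔ ∃ i, M ⊨ b i := by
  induction n with
  | zero => simp [disj, Sentence.Realize, Formula.Realize]
  | succ n ih => rw [disj, Sentence.realize_sup, ih, Fin.exists_fin_succ]

theorem models_not_of_models {O : L.Theory} {φ ψ : L.Sentence} (h : (O ∪ {φ}) ⊨ᵇ ψ) :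
    (O ∪ {ψ.not}) ⊨ᵇ φ.not := by
  rw [Theory.models_sentence_iff]
  intro M
  obtain ⟨hO, hψ⟩ := Theory.model_union_iff.1 M.is_model
  rw [Theory.model_singleton_iff, Sentence.realize_not] at hψ
  rw [Sentence.realize_not]
  intro hφ
  have : M ⊨ O ∪ {φ} := Theory.model_union_iff.2 ⟨hO, Theory.model_singleton_iff.2 hφ⟩
  exact hψ (h.realize_sentence M)

/-- The hypothesis obtained by negating the reduced uniform interpolant is
semantically minimal: it is entailed, relative to `O`, by every hypothesis over `S_A`
explaining `ψ`. -/
theorem reduced_hypothesis_semantically_minimal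
    (ι : L' →ᴸ L) (O : L.Theory) (ψ : L.Sentence)
    (V : L.Theory) (hfin : V.Finite)
    (hUI : IsUniformInterpolant ι (O ∪ {ψ.not}) V)
    (n : ℕ) (b : Fin n → L.Sentence) (hinj : Function.Injective b)
    (hsub : Set.range b ⊆ V)
    (hred : ∀ β ∈ V \ Set.range b, (O ∪ Set.range b) ⊨ᵇ β) :
    ∀ H' : L.Sentence, IsSA ι H' → ((O ∪ {H'}) ⊨ᵇ ψ) →
      (O ∪ {H'}) ⊨ᵇ disj fun i => (b i).not := by
  intro H' hH' hexp
  have hV : V ⊨ᵇ H'.not := (hUI.2 _ hH'.not).1 (models_not_of_models hexp)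
  rw [Theory.models_sentence_iff]
  intro M
  obtain ⟨hO, hM⟩ := Theory.model_union_iff.1 M.is_model
  rw [Theory.model_singleton_iff] at hM
  rw [realize_disj]
  by_contra! hcon
  simp only [Sentence.realize_not, not_not] at hcon
  have hb : M ⊨ Set.range b := (Theory.model_iff _).2 (Set.forall_mem_range.2 hcon)
  have hOb : M ⊨ O ∪ Set.range b := Theory.model_union_iff.2 ⟨hO, hb⟩
  have hMV : M ⊨ V := by
    refine (Theory.model_iff _).2 fun β hβ => ?_
    by_cases hβb : β ∈ Set.range b
    · exact (Theory.model_iff _).1 hb β hβb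
    · exact (hred β ⟨hβ, hβb⟩).realize_sentence M
  exact (Sentence.realize_not M).1 (hV.realize_sentence M) hM

end Abduction
end
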